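/- arXiv:2509.14184 — 3 statements merged into one kernel-verified Lean document; each statement's English description precedes it below -/
import Mathlib

section
/- The cubic graph G* admits no S10-coloring; that is, there is no proper edge-coloring f : E(G*) → E(S10) such that for every vertex v of G* there exists a vertex u of S10 with f(∂_{G*}(v)) = ∂_{S10}(u). -/
/-- A loopless multigraph: each edge has an unordered pair of distinct endpoints.
Parallel edges are allowed. -/
structure Multigraph (V : Type) (E : Type) where
  ends : E → Sym2 V
  loopless : ∀ e, ¬ (ends e).IsDiag

namespace Multigraph

variable {V E V' E' V'' E'' : Type}

/-- `G.inc v` is the set `∂_G(v)` of edges of `G` incident with the vertex `v`. -/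
def inc (G : Multigraph V E) (v : V) : Set E := {e | v ∈ G.ends e}

/-- Two edges are adjacent if they are distinct and share an endpoint. -/
def EdgeAdj (G : Multigraph V E) (e₁ e₂ : E) : Prop :=
  e₁ ≠ e₂ ∧ ∃ v, e₁ ∈ G.inc v ∧ e₂ ∈ G.inc v

/-- `f` is an `H`-coloring of `G`: a proper edge-coloring (adjacent edges of `G` receive
distinct images) such that for every vertex `v` of `G` there is a vertex `u` of `H` with
`f(∂_G(v)) = ∂_H(u)`. -/
def IsColoring (G : Multigraph V E) (H : Multigraph V' E') (f : E → E') : Prop :=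
  (∀ e₁ e₂, G.EdgeAdj e₁ e₂ → f e₁ ≠ f e₂) ∧
  (∀ v : V, ∃ u : V', f '' G.inc v = H.inc u)

end Multigraph

/-- The Sylvester graph `S₁₀`: vertex `0` is the centre `w`; vertices `1,2,3` are
`z₁,z₂,z₃`; vertices `4,5` are `x₁,y₁`; vertices `6,7` are `x₂,y₂`; vertices `8,9` are
`x₃,y₃`.  Edges `9,…,14` are the three pairs of parallel edges. -/
def S10 : Multigraph (Fin 10) (Fin 15) where
  ends := ![s(0,1), s(0,2), s(0,3), s(1,4), s(1,5), s(2,6), s(2,7), s(3,8), s(3,9),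
            s(4,5), s(4,5), s(6,7), s(6,7), s(8,9), s(8,9)]
  loopless := by decide

/-- `A₁` is the set of the six edges of `S₁₀` lying in a pair of parallel edges. -/
def A1 : Set (Fin 15) := {9, 10, 11, 12, 13, 14}

/-- The graph `G*`.  Vertices `0,…,8` induce the Petersen graph minus a vertex `v₀`
(vertices `0`, `3`, `4` are the former neighbours of `v₀`); vertex `9` is `u`;
vertices `10`, `11` are `s₁`, `s₂`; vertices `12,13,14` form the triangle `t₁t₂t₃`;
vertices `15,…,23` are the three attached copies of `S₄` (with `17`, `20`, `23`
the vertices `c` joined to `s₁`, `s₂`, `t₃` respectively).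
Edges `0,…,11` form `E₁` (the copy of the Petersen graph minus a vertex),
edges `12,…,23` form `E₂`, and edges `24,…,35` are the edges of the copies of `S₄`. -/
def Gstar : Multigraph (Fin 24) (Fin 36) where
  ends := ![s(0,1), s(1,2), s(2,3), s(0,5), s(1,6), s(2,7), s(3,8), s(4,6), s(4,7),
            s(5,7), s(5,8), s(6,8),
            s(9,10), s(9,11), s(9,12), s(12,13), s(13,14), s(12,14),
            s(10,0), s(11,3), s(13,4), s(10,17), s(11,20), s(14,23),
            s(15,16), s(15,16), s(15,17), s(16,17),
            s(18,19), s(18,19), s(18,20), s(19,20),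
            s(21,22), s(21,22), s(21,23), s(22,23)]
  loopless := by decide

/-- `E₁`: the edges of the subgraph `H` of `G*` isomorphic to the Petersen graph minus
a vertex. -/
def E1 : Set (Fin 36) := {e | e.val ≤ 11}

/-- `E₂`: the edges of `G*` belonging neither to `E₁` nor to a copy of `S₄`. -/
def E2 : Set (Fin 36) := {e | 12 ≤ e.val ∧ e.val ≤ 23}

namespace Multigraph

variable {V E V' E' : Type}

/-- The three edges of the triple are distinct and share a vertex of `G`. -/
def IsStar (G : Multigraph V E) (t : E × E × E) : Prop :=
  (t.1 ≠ t.2.1 ∧ t.1 ≠ t.2.2 ∧ t.2.1 ≠ t.2.2) ∧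
    ∃ v, v ∈ G.ends t.1 ∧ v ∈ G.ends t.2.1 ∧ v ∈ G.ends t.2.2

instance [Fintype V] [DecidableEq V] [DecidableEq E] (G : Multigraph V E) (t : E × E × E) :
    Decidable (G.IsStar t) :=
  inferInstanceAs (Decidable (_ ∧ _))

theorem IsColoring.isStar_map {G : Multigraph V E} {H : Multigraph V' E'} {f : E → E'}
    (hf : G.IsColoring H f) {i j k : E} (h : G.IsStar (i, j, k)) :
    H.IsStar (f i, f j, f k) := by
  obtain ⟨⟨hij, hik, hjk⟩, v, hi, hj, hk⟩ := h
  obtain ⟨u, hu⟩ := hf.2 v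
  have mem {e : E} (he : v ∈ G.ends e) : u ∈ H.ends (f e) :=
    hu.subset (Set.mem_image_of_mem f he)
  exact ⟨⟨hf.1 i j ⟨hij, v, hi, hj⟩, hf.1 i k ⟨hik, v, hi, hk⟩, hf.1 j k ⟨hjk, v, hj, hk⟩⟩,
    u, mem hi, mem hj, mem hk⟩

end Multigraph

section Search

variable {E C : Type} [BEq E]

/-- Depth-first search for an assignment of colours extending `g` such that for each listed
triple `(i, j, k)` the colours of `j` and `k` form a pair listed in `next` at the colour of `i`.
The value `true` certifies that there is none; the search gives up with the value `false` when
it meets a triple whose first edge has no colour yet. -/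
def refutes [BEq C] (next : C → List (C × C)) : List (E × E × E) → List (E × C) → Bool
  | [], _ => false
  | (i, j, k) :: l, g =>
    match g.lookup i with
    | none => false
    | some a => (next a).all fun p =>
        cond ((g.lookup j).all (· == p.1))
          (cond ((g.lookup k).all (· == p.2)) (refutes next l ((j, p.1) :: (k, p.2) :: g)) true)
          true

theorem lookup_eq_of_forall_mem [LawfulBEq E] {f : E → C} {g : List (E × C)} (hg : ∀ p ∈ g, f p.1 = p.2)
    {e : E} {c : C} (h : g.lookup e = some c) : f e = c := by
  obtain ⟨l₁, l₂, rfl, -⟩ := List.lookup_eq_some_iff.1 h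
  exact hg (e, c) (by simp)

theorem refutes_eq_false [LawfulBEq E] [BEq C] [ReflBEq C] {next : C → List (C × C)}
    {f : E → C} (l : List (E × E × E))
    (hl : ∀ t ∈ l, (f t.2.1, f t.2.2) ∈ next (f t.1)) (g : List (E × C))
    (hg : ∀ p ∈ g, f p.1 = p.2) : refutes next l g = false := by
  induction l generalizing g with
  | nil => rfl
  | cons t l ih =>
    obtain ⟨i, j, k⟩ := t
    have compat (e : E) : (g.lookup e).all (· == f e) = true := by
      cases h : g.lookup e with
      | none => rfl
      | some c => simp [lookup_eq_of_forall_mem hg h]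
    unfold refutes
    split
    · rfl
    · rename_i a ha
      obtain rfl := lookup_eq_of_forall_mem hg ha
      refine List.all_eq_false.2 ⟨(f j, f k), hl (i, j, k) (by simp), ?_⟩
      simp only [compat, cond_true, Bool.not_eq_true]
      refine ih (fun t ht => hl t (List.mem_cons_of_mem _ ht)) _ fun p hp => ?_
      simp only [List.mem_cons] at hp
      rcases hp with rfl | rfl | hp
      exacts [rfl, rfl, hg p hp]

end Search

/-- The pairs of edges of `S₁₀` completing a given edge to the set of all three edges at a
vertex. -/
def starCompletions : Fin 15 → List (Fin 15 × Fin 15) :=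
  ![[(1, 2), (2, 1), (3, 4), (4, 3)], [(0, 2), (2, 0), (5, 6), (6, 5)],
    [(0, 1), (1, 0), (7, 8), (8, 7)], [(0, 4), (4, 0), (9, 10), (10, 9)],
    [(0, 3), (3, 0), (9, 10), (10, 9)], [(1, 6), (6, 1), (11, 12), (12, 11)],
    [(1, 5), (5, 1), (11, 12), (12, 11)], [(2, 8), (8, 2), (13, 14), (14, 13)],
    [(2, 7), (7, 2), (13, 14), (14, 13)], [(3, 10), (10, 3), (4, 10), (10, 4)],
    [(3, 9), (9, 3), (4, 9), (9, 4)], [(5, 12), (12, 5), (6, 12), (12, 6)],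
    [(5, 11), (11, 5), (6, 11), (11, 6)], [(7, 14), (14, 7), (8, 14), (14, 8)],
    [(7, 13), (13, 7), (8, 13), (13, 8)]]

theorem mem_starCompletions {a b c : Fin 15} (h : S10.IsStar (a, b, c)) :
    (b, c) ∈ starCompletions a := by
  have key : ∀ u : Fin 10, ∀ a, u ∈ S10.ends a → ∀ b, u ∈ S10.ends b → ∀ c, u ∈ S10.ends c →
      a ≠ b → a ≠ c → b ≠ c → (b, c) ∈ starCompletions a := by
    decide +kernel
  obtain ⟨⟨hab, hac, hbc⟩, u, ha, hb, hc⟩ := h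
  exact key u a ha b hb c hc hab hac hbc

/-- The edge leaving a copy of `S₄` is coloured with an edge at the centre of `S₁₀`: its two
successors `r`, `s` at the copy both complete the pair of colours `p`, `q` of the parallel
edges. -/
theorem mem_of_starCompletions {p q r s t : Fin 15} (hr : (q, r) ∈ starCompletions p)
    (hs : (q, s) ∈ starCompletions p) (ht : (r, s) ∈ starCompletions t) :
    t ∈ ([0, 1, 2] : List (Fin 15)) := by
  have key : ∀ p, ∀ x ∈ starCompletions p, ∀ y ∈ starCompletions p, x.1 = y.1 →
      ∀ t, (x.2, y.2) ∈ starCompletions t → t ∈ ([0, 1, 2] : List (Fin 15)) := by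
    decide +kernel
  exact key p _ hr _ hs rfl t ht

/-- The edges at the vertices of `G*` outside the copies of `S₄`, in an order in which every
triple starts with an edge that is `21`, `22` or `23` or occurs in an earlier triple. -/
def GstarStars : List (Fin 36 × Fin 36 × Fin 36) :=
  [(21, 12, 18), (22, 13, 19), (12, 13, 14), (14, 15, 17), (23, 16, 17), (15, 16, 20),
    (18, 0, 3), (0, 1, 4), (20, 7, 8), (4, 7, 11), (11, 6, 10), (19, 2, 6), (1, 2, 5),
    (5, 8, 9), (3, 9, 10)]

theorem isStar_of_mem_GstarStars : ∀ t ∈ GstarStars, Gstar.IsStar t :=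
  List.forall_iff_forall_mem.1 (by decide +kernel)

theorem refutes_GstarStars : ∀ a ∈ ([0, 1, 2] : List (Fin 15)),
    ∀ b ∈ ([0, 1, 2] : List (Fin 15)), ∀ c ∈ ([0, 1, 2] : List (Fin 15)),
      refutes starCompletions GstarStars [(21, a), (22, b), (23, c)] = true := by
  decide +kernel

/-- The cubic graph `G*` admits no `S₁₀`-coloring: there is no proper edge-coloring
`f : E(G*) → E(S₁₀)` such that for every vertex `v` of `G*` there is a vertex `u` of
`S₁₀` with `f(∂_{G*}(v)) = ∂_{S₁₀}(u)`. -/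
theorem gstar_admits_no_S10_coloring :
    ¬ ∃ f : Fin 36 → Fin 15, Gstar.IsColoring S10 f := by
  rintro ⟨f, hf⟩
  have pair {i j k : Fin 36} (h : Gstar.IsStar (i, j, k)) :
      (f j, f k) ∈ starCompletions (f i) :=
    mem_starCompletions (hf.isStar_map h)
  have h₁ : f 21 ∈ ([0, 1, 2] : List (Fin 15)) :=
    mem_of_starCompletions (pair (i := 24) (j := 25) (k := 26) (by decide +kernel))
      (pair (k := 27) (by decide +kernel)) (pair (by decide +kernel))
  have h₂ : f 22 ∈ ([0, 1, 2] : List (Fin 15)) :=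
    mem_of_starCompletions (pair (i := 28) (j := 29) (k := 30) (by decide +kernel))
      (pair (k := 31) (by decide +kernel)) (pair (by decide +kernel))
  have h₃ : f 23 ∈ ([0, 1, 2] : List (Fin 15)) :=
    mem_of_starCompletions (pair (i := 32) (j := 33) (k := 34) (by decide +kernel))
      (pair (k := 35) (by decide +kernel)) (pair (by decide +kernel))
  have h := refutes_eq_false (f := f) GstarStars
    (fun t ht => pair (isStar_of_mem_GstarStars t ht))
    [(21, f 21), (22, f 22), (23, f 23)] (by simp)
  rw [refutes_GstarStars _ h₁ _ h₂ _ h₃] at h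
  exact Bool.noConfusion h
end

section
/- The cubic graph G* admits no S12-coloring; that is, there is no proper edge-coloring f : E(G*) → E(S12) such that for every vertex v of G* there exists a vertex u of S12 with f(∂_{G*}(v)) = ∂_{S12}(u). -/
/-- The graph `S₁₂`, obtained from `S₁₀` by replacing the central vertex by a triangle:
vertices `0,1,2` form the triangle (edges `0,1,2`); vertices `3,4,5` are `z₁,z₂,z₃`,
joined to the triangle by edges `3,4,5`; vertices `6,7`, `8,9`, `10,11` are
`x₁,y₁`, `x₂,y₂`, `x₃,y₃`; edges `12,…,17` are the three pairs of parallel edges. -/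
def S12 : Multigraph (Fin 12) (Fin 18) where
  ends := ![s(0,1), s(1,2), s(0,2), s(0,3), s(1,4), s(2,5),
            s(3,6), s(3,7), s(4,8), s(4,9), s(5,10), s(5,11),
            s(6,7), s(6,7), s(8,9), s(8,9), s(10,11), s(10,11)]
  loopless := by decide

/-- The ordered pairs `(b, c)` such that `a`, `b`, `c` are the three edges of `S₁₂` at
a common vertex. -/
def S12.completions (a : ℕ) : List (ℕ × ℕ) :=
  [[(1, 4), (2, 3), (3, 2), (4, 1)],
    [(0, 4), (2, 5), (4, 0), (5, 2)],
    [(0, 3), (1, 5), (3, 0), (5, 1)],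
    [(0, 2), (2, 0), (6, 7), (7, 6)],
    [(0, 1), (1, 0), (8, 9), (9, 8)],
    [(1, 2), (2, 1), (10, 11), (11, 10)],
    [(3, 7), (7, 3), (12, 13), (13, 12)],
    [(3, 6), (6, 3), (12, 13), (13, 12)],
    [(4, 9), (9, 4), (14, 15), (15, 14)],
    [(4, 8), (8, 4), (14, 15), (15, 14)],
    [(5, 11), (11, 5), (16, 17), (17, 16)],
    [(5, 10), (10, 5), (16, 17), (17, 16)],
    [(6, 13), (7, 13), (13, 6), (13, 7)],
    [(6, 12), (7, 12), (12, 6), (12, 7)],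
    [(8, 15), (9, 15), (15, 8), (15, 9)],
    [(8, 14), (9, 14), (14, 8), (14, 9)],
    [(10, 17), (11, 17), (17, 10), (17, 11)],
    [(10, 16), (11, 16), (16, 10), (16, 11)]].getD a []

/-- The bridge of `S₁₂` lying in, or attached to, the same end of `S₁₂` as the given edge;
`0` for the edges of the central triangle. -/
def S12.bridgeOf (a : ℕ) : ℕ :=
  [0, 0, 0, 3, 4, 5, 3, 3, 4, 4, 5, 5, 3, 3, 4, 4, 5, 5].getD a 0

namespace S12

theorem mem_completions :
    ∀ u a, u ∈ S12.ends a → ∀ b, u ∈ S12.ends b → a ≠ b → ∀ c, u ∈ S12.ends c →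
      a ≠ c → b ≠ c → (b.val, c.val) ∈ completions a := by
  decide +kernel

/-- In an `S₁₂`-coloring, the edge leaving an `S₄` (double edge `p`, `q`, single edges
`r`, `s`, outgoing edge `t`) is mapped to a bridge. -/
theorem bridge_of_S4 {p q r s t : ℕ} (ha : (q, r) ∈ completions p)
    (hb : (q, s) ∈ completions p) (hc : (s, t) ∈ completions r) (hp : p < 18) :
    t ∈ [3, 4, 5] := by
  have key : ∀ p < 18, ∀ a ∈ completions p, ∀ b ∈ completions p, b.1 = a.1 →
      ∀ c ∈ completions a.2, c.1 = b.2 → c.2 ∈ [3, 4, 5] := by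
    decide +kernel
  exact key p hp _ ha _ hb rfl _ hc rfl

/-- In an `S₁₂`-coloring of the Petersen graph minus a vertex with three pendant edges
`x`, `y`, `z`, the pendant edges are all mapped into the same end of `S₁₂`. -/
theorem bridgeOf_petersen {f : Fin 12 → ℕ} {x y z : ℕ} (hx : x < 18)
    (h0 : (f 0, f 3) ∈ completions x) (h1 : (f 1, f 4) ∈ completions (f 0))
    (h5 : (f 9, f 10) ∈ completions (f 3)) (h2 : (f 2, f 5) ∈ completions (f 1))
    (h7 : (f 5, f 8) ∈ completions (f 9)) (h3 : (f 6, y) ∈ completions (f 2))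
    (h8 : (f 6, f 11) ∈ completions (f 10)) (h6 : (f 7, f 11) ∈ completions (f 4))
    (h4 : (f 7, z) ∈ completions (f 8)) :
    bridgeOf x ≠ 0 ∧ bridgeOf y = bridgeOf x ∧ bridgeOf z = bridgeOf x := by
  have key : ((List.range 18).all fun x ↦ (completions x).all fun v0 ↦
      (completions v0.1).all fun v1 ↦ (completions v0.2).all fun v5 ↦
      (completions v1.1).all fun v2 ↦ (completions v5.1).all fun v7 ↦ v7.1 != v2.2 ||
      (completions v2.1).all fun v3 ↦ (completions v5.2).all fun v8 ↦ v8.1 != v3.1 ||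
      (completions v1.2).all fun v6 ↦ v6.2 != v8.2 ||
      (completions v7.2).all fun v4 ↦ v4.1 != v6.1 ||
      (bridgeOf x != 0 && bridgeOf v3.2 == bridgeOf x && bridgeOf v4.2 == bridgeOf x)) = true := by
    decide +kernel
  simp only [List.all_eq_true, List.mem_range, Bool.or_eq_true, Bool.and_eq_true, bne_iff_ne,
    beq_iff_eq, ne_eq, ← imp_iff_not_or, and_assoc] at key
  exact key x hx _ h0 _ h1 _ h5 _ h2 _ h7 rfl _ h3 _ h8 rfl _ h6 rfl _ h4 rfl

/-- In an `S₁₂`-coloring of the part of `G*` around `u` whose edges towards the copies of `S₄`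
are mapped to bridges, the edges `x`, `y`, `z` towards the Petersen graph minus a vertex are not
all mapped into the same end of `S₁₂`. Here `a`, `b`, `c` are the edges at `u`, and `p`, `q`, `r`
are the edges of the triangle. -/
theorem bridgeOf_center {a b c p q r x y z j k l : ℕ}
    (hj : j ∈ [3, 4, 5]) (hk : k ∈ [3, 4, 5]) (hl : l ∈ [3, 4, 5])
    (hs₁ : (a, x) ∈ completions j) (hs₂ : (b, y) ∈ completions k)
    (hu : (b, c) ∈ completions a) (ht₃ : (q, r) ∈ completions l)
    (ht₁ : (p, r) ∈ completions c) (ht₂ : (p, z) ∈ completions q) :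
    ¬ (bridgeOf x ≠ 0 ∧ bridgeOf y = bridgeOf x ∧ bridgeOf z = bridgeOf x) := by
  have key : ∀ j ∈ [3, 4, 5], ∀ s₁ ∈ completions j, ∀ k ∈ [3, 4, 5], ∀ s₂ ∈ completions k,
      ∀ u ∈ completions s₁.1, u.1 = s₂.1 →
      ∀ l ∈ [3, 4, 5], ∀ t₃ ∈ completions l, ∀ t₁ ∈ completions u.2, t₁.2 = t₃.2 →
      ∀ t₂ ∈ completions t₃.1, t₂.1 = t₁.1 →
      ¬ (bridgeOf s₁.2 ≠ 0 ∧ bridgeOf s₂.2 = bridgeOf s₁.2 ∧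
        bridgeOf t₂.2 = bridgeOf s₁.2) := by
    decide +kernel
  exact key j hj _ hs₁ k hk _ hs₂ _ hu rfl l hl _ ht₃ _ ht₁ rfl _ ht₂ rfl

end S12

theorem Multigraph.IsColoring.mem_completions {V E : Type} {G : Multigraph V E} {f : E → Fin 18}
    (hf : G.IsColoring S12 f) (v : V) {x y z : E}
    (hv : v ∈ G.ends x ∧ v ∈ G.ends y ∧ v ∈ G.ends z) (hne : x ≠ y ∧ x ≠ z ∧ y ≠ z) :
    ((f y).val, (f z).val) ∈ S12.completions (f x) := by
  obtain ⟨hx, hy, hz⟩ := hv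
  obtain ⟨hxy, hxz, hyz⟩ := hne
  obtain ⟨u, hu⟩ := hf.2 v
  have himg {e : E} (he : v ∈ G.ends e) : u ∈ S12.ends (f e) :=
    (hu.subset ⟨e, he, rfl⟩ : f e ∈ S12.inc u)
  exact S12.mem_completions u _ (himg hx) _ (himg hy) (hf.1 _ _ ⟨hxy, v, hx, hy⟩)
    _ (himg hz) (hf.1 _ _ ⟨hxz, v, hx, hz⟩) (hf.1 _ _ ⟨hyz, v, hy, hz⟩)

/-- The cubic graph `G*` admits no `S₁₂`-coloring: there is no proper edge-coloring
`f : E(G*) → E(S₁₂)` such that for every vertex `v` of `G*` there is a vertex `u` of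
`S₁₂` with `f(∂_{G*}(v)) = ∂_{S₁₂}(u)`. -/
theorem gstar_admits_no_S12_coloring :
    ¬ ∃ f : Fin 36 → Fin 18, Gstar.IsColoring S12 f := by
  rintro ⟨f, hf⟩
  have hinc (v : Fin 24) (x y z : Fin 36)
      (hv : v ∈ Gstar.ends x ∧ v ∈ Gstar.ends y ∧ v ∈ Gstar.ends z)
      (hne : x ≠ y ∧ x ≠ z ∧ y ≠ z) : ((f y).val, (f z).val) ∈ S12.completions (f x) :=
    hf.mem_completions v hv hne
  have hj : (f 21).val ∈ [3, 4, 5] := S12.bridge_of_S4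
    (hinc 15 24 25 26 (by decide) (by decide)) (hinc 16 24 25 27 (by decide) (by decide))
    (hinc 17 26 27 21 (by decide) (by decide)) (f _).isLt
  have hk : (f 22).val ∈ [3, 4, 5] := S12.bridge_of_S4
    (hinc 18 28 29 30 (by decide) (by decide)) (hinc 19 28 29 31 (by decide) (by decide))
    (hinc 20 30 31 22 (by decide) (by decide)) (f _).isLt
  have hl : (f 23).val ∈ [3, 4, 5] := S12.bridge_of_S4
    (hinc 21 32 33 34 (by decide) (by decide)) (hinc 22 32 33 35 (by decide) (by decide))
    (hinc 23 34 35 23 (by decide) (by decide)) (f _).isLt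
  refine S12.bridgeOf_center hj hk hl
    (hinc 10 21 12 18 (by decide) (by decide)) (hinc 11 22 13 19 (by decide) (by decide))
    (hinc 9 12 13 14 (by decide) (by decide)) (hinc 14 23 16 17 (by decide) (by decide))
    (hinc 12 14 15 17 (by decide) (by decide)) (hinc 13 16 15 20 (by decide) (by decide)) ?_
  exact S12.bridgeOf_petersen (f := fun e ↦ f (e.castLE (by decide))) (f 18).isLt
    (hinc 0 18 0 3 (by decide) (by decide)) (hinc 1 0 1 4 (by decide) (by decide))
    (hinc 5 3 9 10 (by decide) (by decide)) (hinc 2 1 2 5 (by decide) (by decide))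
    (hinc 7 9 5 8 (by decide) (by decide)) (hinc 3 2 6 19 (by decide) (by decide))
    (hinc 8 10 6 11 (by decide) (by decide)) (hinc 6 4 7 11 (by decide) (by decide))
    (hinc 4 8 7 20 (by decide) (by decide))
end

section
/- The chromatic index of the graph obtained from the Petersen graph by deleting one vertex is 4. -/
/-- The graph obtained from the Petersen graph by deleting one vertex.
Vertices `0`, `3`, `4` are the neighbours of the deleted vertex. -/
def PminusV : Multigraph (Fin 9) (Fin 12) where
  ends := ![s(0,1), s(1,2), s(2,3), s(0,5), s(1,6), s(2,7), s(3,8), s(4,6), s(4,7),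
            s(5,7), s(5,8), s(6,8)]
  loopless := by decide

/-- `G.chromIndexOn F` is the chromatic index of the subgraph of `G` induced by the
edge set `F`: the least `k` such that `F` can be partitioned into `k` matchings,
i.e. such that there is a proper edge-coloring of the edges of `F` with `k` colors. -/
noncomputable def Multigraph.chromIndexOn {V E : Type} (G : Multigraph V E)
    (F : Set E) : ℕ :=
  sInf {k | ∃ c : E → Fin k, ∀ e₁ ∈ F, ∀ e₂ ∈ F, G.EdgeAdj e₁ e₂ → c e₁ ≠ c e₂}

namespace PetersenMinusVertex

instance : DecidableRel PminusV.EdgeAdj := fun e₁ e₂ =>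
  inferInstanceAs (Decidable (e₁ ≠ e₂ ∧ ∃ v, v ∈ PminusV.ends e₁ ∧ v ∈ PminusV.ends e₂))

/-- A proper edge-coloring of `PminusV` with four colors. -/
def fourColoring : Fin 12 → Fin 4 := ![0, 1, 0, 1, 2, 2, 3, 0, 1, 0, 2, 1]

theorem fourColoring_proper :
    ∀ e₁ e₂, PminusV.EdgeAdj e₁ e₂ → fourColoring e₁ ≠ fourColoring e₂ := by
  decide

/-- The edges are ordered so that an exhaustive search fails early. -/
theorem false_of_three_colors :
    ∀ a b : Fin 3, a ≠ b → ∀ d, d ≠ a → d ≠ b →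
    ∀ x, b ≠ x → ∀ y, b ≠ y → x ≠ y →
    ∀ z, d ≠ z → ∀ w, d ≠ w → z ≠ w →
    ∀ r, r ≠ z → r ≠ y → ∀ s, y ≠ s → r ≠ s →
    ∀ p, a ≠ p → p ≠ s → ∀ t, t ≠ p → t ≠ s → t ≠ w →
    ∀ q, q ≠ x → q ≠ t → q ≠ w → False := by
  decide

theorem not_three_edge_colorable (c : Fin 12 → Fin 3) :
    ¬ ∀ e₁ e₂, PminusV.EdgeAdj e₁ e₂ → c e₁ ≠ c e₂ := by
  intro h
  refine false_of_three_colors (c 0) (c 1) ?_ (c 4) ?_ ?_ (c 2) ?_ (c 5) ?_ ?_ (c 7) ?_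
    (c 11) ?_ ?_ (c 8) ?_ ?_ (c 9) ?_ ?_ (c 3) ?_ ?_ (c 10) ?_ ?_ ?_ (c 6) ?_ ?_ ?_ <;>
  exact h _ _ (by decide)

end PetersenMinusVertex

/-- The chromatic index of the graph obtained from the Petersen graph by deleting one
vertex is 4. -/
theorem chromIndex_petersen_minus_vertex :
    PminusV.chromIndexOn Set.univ = 4 := by
  have h4 : 4 ∈ {k | ∃ c : Fin 12 → Fin k, ∀ e₁ ∈ Set.univ, ∀ e₂ ∈ Set.univ,
      PminusV.EdgeAdj e₁ e₂ → c e₁ ≠ c e₂} :=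
    ⟨PetersenMinusVertex.fourColoring, fun e₁ _ e₂ _ => PetersenMinusVertex.fourColoring_proper e₁ e₂⟩
  refine le_antisymm (Nat.sInf_le h4) (le_csInf ⟨4, h4⟩ ?_)
  rintro k ⟨c, hc⟩
  by_contra! hk
  refine PetersenMinusVertex.not_three_edge_colorable (fun e => Fin.castLE (by lia) (c e))
    fun e₁ e₂ h heq => ?_
  exact hc e₁ trivial e₂ trivial h (Fin.castLE_injective _ heq)
end
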